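/- Osgood-type uniqueness for the controlled equation: assume the local integrability condition ∫₀¹ sup_{|x| ≤ R}(|b(s,x)| + ‖σ(s,x)‖²) ds < ∞ for every R > 0, and the local Osgood-type condition: there is c₀ ∈ (0,1) such that for every R > 0 there exist a nonnegative f_R with ∫₀¹ f_R(t)² dt < ∞ and a differentiable η_R : [0,1) → ℝ₊ with η_R(0) = 0, η_R' ≥ 0 and ∫_{0+} du/η_R(u) = ∞, such that max(⟨x − y, b(t,x) − b(t,y)⟩, |(σ(t,x) − σ(t,y))ᵀ(x − y)|) ≤ f_R(t) η_R(|x − y|²) whenever |x| ∨ |y| ≤ R, |x − y| < c₀ and t ∈ [0,1]. Then for every absolutely continuous l : [0,1] → ℝ^m with l(0) = 0 and ∫₀¹ |l'(t)|² dt < ∞, any two solutions of the controlled equation driven by l coincide on [0,1]. -/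

import Mathlib

open MeasureTheory Set Metric
open scoped RealInnerProductSpace ENNReal

noncomputable section

/-- Matrix times vector, landing in Euclidean space. -/
def mVec {d m : ℕ} (A : Matrix (Fin d) (Fin m) ℝ)
    (v : EuclideanSpace ℝ (Fin m)) : EuclideanSpace ℝ (Fin d) :=
  (WithLp.equiv 2 (Fin d → ℝ)).symm fun i => ∑ j, A i j * v j

/-- Transposed matrix times vector (`σᵀ x`), landing in Euclidean space. -/
def mVecT {d m : ℕ} (A : Matrix (Fin d) (Fin m) ℝ)
    (x : EuclideanSpace ℝ (Fin d)) : EuclideanSpace ℝ (Fin m) :=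
  (WithLp.equiv 2 (Fin m → ℝ)).symm fun j => ∑ i, A i j * x i

/-- Square of the Frobenius (Hilbert–Schmidt) norm `‖A‖² = ∑ᵢⱼ Aᵢⱼ²`. -/
def frobSq {d m : ℕ} (A : Matrix (Fin d) (Fin m) ℝ) : ℝ :=
  ∑ i, ∑ j, (A i j) ^ 2

/-- An admissible control: `l'` is (a.e. strongly) measurable on `[0,1]` and
`∫₀¹ ‖l'(t)‖² dt < ∞`; `l'` plays the role of the derivative of an absolutely
continuous path `l` with `l(0) = 0`, so that `e(l) = ∫₀¹ ‖l'(t)‖² dt`. -/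
def Adm {m : ℕ} (l' : ℝ → EuclideanSpace ℝ (Fin m)) : Prop :=
  AEStronglyMeasurable l' (volume.restrict (Icc 0 1)) ∧
    IntegrableOn (fun t => ‖l' t‖ ^ 2) (Icc 0 1)

/-- `h` is a solution on `[0,1]` of the controlled equation
`h(t) = x₀ + ∫₀ᵗ b(s, h(s)) ds + ∫₀ᵗ σ(s, h(s)) l'(s) ds` driven by the
absolutely continuous path `l` with derivative `l'`. -/
def IsSol {d m : ℕ} (b : ℝ → EuclideanSpace ℝ (Fin d) → EuclideanSpace ℝ (Fin d))
    (σ : ℝ → EuclideanSpace ℝ (Fin d) → Matrix (Fin d) (Fin m) ℝ)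
    (x₀ : EuclideanSpace ℝ (Fin d)) (l' : ℝ → EuclideanSpace ℝ (Fin m))
    (h : ℝ → EuclideanSpace ℝ (Fin d)) : Prop :=
  ContinuousOn h (Icc 0 1) ∧ ∀ t ∈ Icc (0:ℝ) 1,
    h t = x₀ + ∫ s in (0:ℝ)..t, (b s (h s) + mVec (σ s (h s)) (l' s))

/-- A function whose increments are dominated by those of an absolutely continuous function is
absolutely continuous. -/
theorem AbsolutelyContinuousOnInterval.of_dist_le {X Y : Type*} [PseudoMetricSpace X]
    [PseudoMetricSpace Y] {f : ℝ → X} {g : ℝ → Y} {a b C : ℝ}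
    (hg : AbsolutelyContinuousOnInterval g a b)
    (h : ∀ x ∈ uIcc a b, ∀ y ∈ uIcc a b, dist (f x) (f y) ≤ C * dist (g x) (g y)) :
    AbsolutelyContinuousOnInterval f a b := by
  rw [absolutelyContinuousOnInterval_iff] at hg ⊢
  intro ε hε
  obtain ⟨δ, hδ, H⟩ := hg (ε / (|C| + 1)) (by positivity)
  refine ⟨δ, hδ, fun E hE hEδ ↦ ?_⟩
  calc ∑ i ∈ Finset.range E.1, dist (f (E.2 i).1) (f (E.2 i).2)
      ≤ ∑ i ∈ Finset.range E.1, C * dist (g (E.2 i).1) (g (E.2 i).2) :=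
        Finset.sum_le_sum fun i hi ↦ h _ (hE.1 i hi).1 _ (hE.1 i hi).2
    _ = C * ∑ i ∈ Finset.range E.1, dist (g (E.2 i).1) (g (E.2 i).2) := by
        rw [Finset.mul_sum]
    _ ≤ (|C| + 1) * ∑ i ∈ Finset.range E.1, dist (g (E.2 i).1) (g (E.2 i).2) := by
        gcongr
        linarith [le_abs_self C]
    _ < (|C| + 1) * (ε / (|C| + 1)) := by
        gcongr
        exact H E hE hEδ
    _ = ε := by field_simp

/-- If `φ` climbs from `0` to `c` subject to `φ' ≤ k η(φ)`, then the integral of `k` bounds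
`∫ 1 / (η + δ)`. -/
theorem integral_one_div_add_le {φ k η : ℝ → ℝ} {T c δ : ℝ} (hT : 0 ≤ T) (hδ : 0 < δ)
    (hφ : AbsolutelyContinuousOnInterval φ 0 T) (hφ0 : φ 0 = 0) (hφT : φ T = c)
    (hη : Continuous η) (hη0 : ∀ u, 0 ≤ η u)
    (hk : IntervalIntegrable k volume 0 T) (hk0 : ∀ t, 0 ≤ k t)
    (hderiv : ∀ᵐ t, t ∈ Icc 0 T → deriv φ t ≤ k t * η (φ t)) :
    ∫ u in (0 : ℝ)..c, 1 / (η u + δ) ≤ ∫ t in (0 : ℝ)..T, k t := by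
  have hpos : ∀ u, 0 < η u + δ := fun u ↦ by linarith [hη0 u]
  have hcont : Continuous fun u ↦ 1 / (η u + δ) :=
    continuous_const.div (hη.add continuous_const) fun u ↦ (hpos u).ne'
  set G : ℝ → ℝ := fun x ↦ ∫ u in (0 : ℝ)..x, 1 / (η u + δ) with hG
  have hGderiv (x : ℝ) : HasDerivAt G (1 / (η x + δ)) x :=
    (hcont.integral_hasStrictDerivAt 0 x).hasDerivAt
  have hGφ : AbsolutelyContinuousOnInterval (G ∘ φ) 0 T := by
    refine hφ.of_dist_le (C := 1 / δ) fun x _ y _ ↦ ?_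
    rw [Real.dist_eq, Real.dist_eq, Function.comp, Function.comp, hG,
      intervalIntegral.integral_interval_sub_left (hcont.intervalIntegrable _ _)
        (hcont.intervalIntegrable _ _), ← Real.norm_eq_abs]
    refine intervalIntegral.norm_integral_le_of_norm_le_const fun u _ ↦ ?_
    rw [Real.norm_of_nonneg (by have := hpos u; positivity)]
    exact one_div_le_one_div_of_le hδ (by linarith [hη0 u])
  calc ∫ u in (0 : ℝ)..c, 1 / (η u + δ) = ∫ t in (0 : ℝ)..T, deriv (G ∘ φ) t := by
        rw [hGφ.integral_deriv_eq_sub]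
        simp [hG, hφ0, hφT]
    _ ≤ ∫ t in (0 : ℝ)..T, k t := by
        refine intervalIntegral.integral_mono_ae_restrict hT hGφ.intervalIntegrable_deriv hk ?_
        rw [Filter.EventuallyLE, ae_restrict_iff' measurableSet_Icc]
        filter_upwards [hderiv, hφ.ae_differentiableAt] with t ht hdiff htT
        rw [((hGderiv (φ t)).comp t (hdiff (by rwa [uIcc_of_le hT])).hasDerivAt).deriv,
          one_div_mul_eq_div, div_le_iff₀ (hpos _)]
        have := mul_nonneg (hk0 t) hδ.le
        linarith [ht htT]

/-- **Osgood's criterion**: if `φ` climbs from `0` to `c` subject to `φ' ≤ k η(φ)` with `k`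
integrable, then `∫ 1 / η` over `(0, c]` is finite. -/
theorem lintegral_one_div_le {φ k η : ℝ → ℝ} {T c : ℝ} (hT : 0 ≤ T)
    (hφ : AbsolutelyContinuousOnInterval φ 0 T) (hφ0 : φ 0 = 0) (hφT : φ T = c)
    (hφmem : ∀ t ∈ Icc 0 T, φ t ∈ Icc 0 c)
    (hη : ContinuousOn η (Icc 0 c)) (hη0 : ∀ u ∈ Icc 0 c, 0 ≤ η u)
    (hk : IntervalIntegrable k volume 0 T) (hk0 : ∀ t, 0 ≤ k t)
    (hderiv : ∀ᵐ t, t ∈ Icc 0 T → deriv φ t ≤ k t * η (φ t)) :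
    ∫⁻ u in Ioc 0 c, ENNReal.ofReal (1 / η u) ≤ ENNReal.ofReal (∫ t in (0 : ℝ)..T, k t) := by
  have hc : 0 ≤ c := (hφmem 0 ⟨le_rfl, hT⟩).1.trans (hφmem 0 ⟨le_rfl, hT⟩).2
  set ζ : ℝ → ℝ := IccExtend hc ((Icc 0 c).domRestrict η) with hζ
  have hζc : Continuous ζ := hη.domRestrict.Icc_extend'
  have hζη : ∀ u ∈ Icc 0 c, ζ u = η u := fun u hu ↦ IccExtend_of_mem hc _ hu
  have hζ0 : ∀ u, 0 ≤ ζ u := fun u ↦ hη0 _ (projIcc 0 c hc u).2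
  let F (n : ℕ) (u : ℝ) : ℝ≥0∞ := ENNReal.ofReal (1 / (ζ u + 1 / ((n : ℝ) + 1)))
  have hFcont (n : ℕ) : Continuous fun u ↦ 1 / (ζ u + 1 / ((n : ℝ) + 1)) :=
    continuous_const.div (hζc.add continuous_const) fun u ↦ by
      have := hζ0 u
      positivity
  have hF (n : ℕ) : ∫⁻ u in Ioc 0 c, F n u ≤ ENNReal.ofReal (∫ t in (0 : ℝ)..T, k t) := by
    rw [← ofReal_integral_eq_lintegral_ofReal ((hFcont n).integrableOn_Ioc)
      (Filter.Eventually.of_forall fun u ↦ by have := hζ0 u; simp only [Pi.zero_apply]; positivity),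
      ← intervalIntegral.integral_of_le hc]
    refine ENNReal.ofReal_le_ofReal (integral_one_div_add_le hT (by positivity) hφ hφ0 hφT hζc hζ0
      hk hk0 ?_)
    filter_upwards [hderiv] with t ht htT
    rw [hζη _ (hφmem t htT)]
    exact ht htT
  have hlim : ∀ u ∈ Ioc 0 c,
      ENNReal.ofReal (1 / η u) ≤ Filter.liminf (fun n ↦ F n u) Filter.atTop := by
    intro u hu
    rw [← hζη u (Ioc_subset_Icc_self hu)]
    rcases (hζ0 u).eq_or_lt with h0 | h0
    · simp [← h0]
    · refine (Filter.Tendsto.liminf_eq (ENNReal.tendsto_ofReal ?_)).ge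
      refine tendsto_const_nhds.div ?_ h0.ne'
      simpa using tendsto_const_nhds.add (tendsto_one_div_add_atTop_nhds_zero_nat (𝕜 := ℝ))
  calc ∫⁻ u in Ioc 0 c, ENNReal.ofReal (1 / η u)
      ≤ ∫⁻ u in Ioc 0 c, Filter.liminf (fun n ↦ F n u) Filter.atTop :=
        setLIntegral_mono' measurableSet_Ioc hlim
    _ ≤ Filter.liminf (fun n ↦ ∫⁻ u in Ioc 0 c, F n u) Filter.atTop :=
        lintegral_liminf_le fun n ↦ (hFcont n).measurable.ennreal_ofReal
    _ ≤ ENNReal.ofReal (∫ t in (0 : ℝ)..T, k t) :=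
        Filter.liminf_le_of_le (by isBoundedDefault) fun b hb ↦ by
          obtain ⟨n, hn⟩ := hb.exists
          exact hn.trans (hF n)

theorem inner_mVec_eq_inner_mVecT {d m : ℕ} (A : Matrix (Fin d) (Fin m) ℝ)
    (x : EuclideanSpace ℝ (Fin d)) (v : EuclideanSpace ℝ (Fin m)) :
    ⟪x, mVec A v⟫ = ⟪mVecT A x, v⟫ := by
  simp only [mVec, mVecT, PiLp.inner_apply, WithLp.equiv_symm_apply, RCLike.inner_apply, conj_trivial,
    Finset.sum_mul, Finset.mul_sum]
  rw [Finset.sum_comm]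
  exact Finset.sum_congr rfl fun j _ ↦ Finset.sum_congr rfl fun i _ ↦ by ring

theorem mVec_sub_mVec {d m : ℕ} (A B : Matrix (Fin d) (Fin m) ℝ)
    (v : EuclideanSpace ℝ (Fin m)) : mVec A v - mVec B v = mVec (A - B) v := by
  ext i
  simp [mVec, sub_mul, Finset.sum_sub_distrib]

theorem frobSq_nonneg {d m : ℕ} (A : Matrix (Fin d) (Fin m) ℝ) : 0 ≤ frobSq A :=
  Finset.sum_nonneg fun _ _ ↦ Finset.sum_nonneg fun _ _ ↦ sq_nonneg _

theorem norm_mVec_sq_le {d m : ℕ} (A : Matrix (Fin d) (Fin m) ℝ)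
    (v : EuclideanSpace ℝ (Fin m)) : ‖mVec A v‖ ^ 2 ≤ frobSq A * ‖v‖ ^ 2 := by
  rw [EuclideanSpace.real_norm_sq_eq, EuclideanSpace.real_norm_sq_eq, frobSq, Finset.sum_mul]
  exact Finset.sum_le_sum fun i _ ↦ Finset.sum_mul_sq_le_sq_mul_sq Finset.univ (A i) v

theorem norm_mVec_le {d m : ℕ} (A : Matrix (Fin d) (Fin m) ℝ)
    (v : EuclideanSpace ℝ (Fin m)) : ‖mVec A v‖ ≤ frobSq A + ‖v‖ ^ 2 := by
  have hA := frobSq_nonneg A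
  refine (abs_le_of_sq_le_sq' ?_ (by positivity)).2
  nlinarith [norm_mVec_sq_le A v, mul_nonneg hA (sq_nonneg ‖v‖), sq_nonneg (frobSq A),
    sq_nonneg (‖v‖ ^ 2)]

/-- Along a continuous path, the right-hand side of the controlled equation is integrable. -/
theorem integrableOn_drift {d m : ℕ}
    {b : ℝ → EuclideanSpace ℝ (Fin d) → EuclideanSpace ℝ (Fin d)}
    {σ : ℝ → EuclideanSpace ℝ (Fin d) → Matrix (Fin d) (Fin m) ℝ}
    (hbmeas : Measurable (Function.uncurry b))
    (hσmeas : ∀ i j, Measurable fun p : ℝ × EuclideanSpace ℝ (Fin d) => σ p.1 p.2 i j)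
    (hloc : ∀ R > (0 : ℝ), ∫⁻ s in Icc (0 : ℝ) 1,
      ⨆ x ∈ Metric.closedBall (0 : EuclideanSpace ℝ (Fin d)) R,
        ENNReal.ofReal (‖b s x‖ + frobSq (σ s x)) < ⊤)
    {l' : ℝ → EuclideanSpace ℝ (Fin m)} (hl : Adm l')
    {h : ℝ → EuclideanSpace ℝ (Fin d)} (hh : ContinuousOn h (Icc 0 1)) :
    IntegrableOn (fun s ↦ b s (h s) + mVec (σ s (h s)) (l' s)) (Icc 0 1) := by
  have hpair : AEMeasurable (fun s ↦ (s, h s)) (volume.restrict (Icc 0 1)) :=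
    aemeasurable_id.prodMk (hh.aemeasurable measurableSet_Icc)
  have hb : AEMeasurable (fun s ↦ b s (h s)) (volume.restrict (Icc 0 1)) :=
    hbmeas.comp_aemeasurable hpair
  have hσ : AEMeasurable (fun s ↦ mVec (σ s (h s)) (l' s)) (volume.restrict (Icc 0 1)) := by
    refine (WithLp.measurable_toLp 2 _).comp_aemeasurable (aemeasurable_pi_lambda _ fun i ↦ ?_)
    refine Finset.aemeasurable_fun_sum _ fun j _ ↦ ?_
    exact ((hσmeas i j).comp_aemeasurable hpair).mul
      ((EuclideanSpace.proj (𝕜 := ℝ) j).continuous.measurable.comp_aemeasurable hl.1.aemeasurable)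
  obtain ⟨R, hR⟩ := isCompact_Icc.exists_bound_of_continuousOn hh
  have hfin : ∫⁻ s in Icc (0 : ℝ) 1, ENNReal.ofReal (‖l' s‖ ^ 2) < ⊤ := by
    have := hl.2.2
    rwa [hasFiniteIntegral_iff_ofReal (Filter.Eventually.of_forall fun s ↦ by positivity)] at this
  refine ⟨(hb.add hσ).aestronglyMeasurable, ?_⟩
  rw [hasFiniteIntegral_iff_norm]
  calc ∫⁻ s in Icc (0 : ℝ) 1, ENNReal.ofReal ‖b s (h s) + mVec (σ s (h s)) (l' s)‖
      ≤ ∫⁻ s in Icc (0 : ℝ) 1,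
        ((⨆ x ∈ Metric.closedBall (0 : EuclideanSpace ℝ (Fin d)) (max R 1),
          ENNReal.ofReal (‖b s x‖ + frobSq (σ s x))) + ENNReal.ofReal (‖l' s‖ ^ 2)) := by
        refine setLIntegral_mono' measurableSet_Icc fun s hs ↦ ?_
        have hmem : h s ∈ Metric.closedBall (0 : EuclideanSpace ℝ (Fin d)) (max R 1) := by
          rw [mem_closedBall_zero_iff]
          exact (hR s hs).trans (le_max_left _ _)
        calc ENNReal.ofReal ‖b s (h s) + mVec (σ s (h s)) (l' s)‖
            ≤ ENNReal.ofReal ((‖b s (h s)‖ + frobSq (σ s (h s))) + ‖l' s‖ ^ 2) := by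
              refine ENNReal.ofReal_le_ofReal ((norm_add_le _ _).trans ?_)
              linarith [norm_mVec_le (σ s (h s)) (l' s)]
          _ ≤ ENNReal.ofReal (‖b s (h s)‖ + frobSq (σ s (h s))) + ENNReal.ofReal (‖l' s‖ ^ 2) :=
              ENNReal.ofReal_add_le
          _ ≤ _ := by
              gcongr
              exact le_iSup₂ (f := fun x _ ↦ ENNReal.ofReal (‖b s x‖ + frobSq (σ s x))) (h s) hmem
    _ = (∫⁻ s in Icc (0 : ℝ) 1, ⨆ x ∈ Metric.closedBall (0 : EuclideanSpace ℝ (Fin d)) (max R 1),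
          ENNReal.ofReal (‖b s x‖ + frobSq (σ s x)))
        + ∫⁻ s in Icc (0 : ℝ) 1, ENNReal.ofReal (‖l' s‖ ^ 2) :=
        lintegral_add_right' _ hl.2.1.aemeasurable.ennreal_ofReal
    _ < ⊤ := ENNReal.add_lt_top.2 ⟨hloc _ (by positivity), hfin⟩

/-- The squared norm of a primitive of an integrable function is absolutely continuous. -/
theorem absolutelyContinuousOnInterval_norm_sq_integral {E : Type*} [NormedAddCommGroup E]
    [NormedSpace ℝ E] {g : ℝ → E} {a b : ℝ} (hg : IntervalIntegrable g volume a b) :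
    AbsolutelyContinuousOnInterval (fun t ↦ ‖∫ s in a..t, g s‖ ^ 2) a b := by
  have hnorm := hg.norm.absolutelyContinuousOnInterval_intervalIntegral left_mem_uIcc
  have hV : AbsolutelyContinuousOnInterval (fun t ↦ ∫ s in a..t, g s) a b := by
    refine hnorm.of_dist_le (C := 1) fun x hx y hy ↦ ?_
    have hint : ∀ z ∈ uIcc a b, IntervalIntegrable g volume a z := fun z hz ↦
      hg.mono_set (uIcc_subset_uIcc_left hz)
    rw [dist_eq_norm, Real.dist_eq, one_mul,
      intervalIntegral.integral_interval_sub_left (hint x hx) (hint y hy),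
      intervalIntegral.integral_interval_sub_left (hint x hx).norm (hint y hy).norm]
    exact intervalIntegral.norm_integral_le_abs_integral_norm
  have hVn : AbsolutelyContinuousOnInterval (fun t ↦ ‖∫ s in a..t, g s‖) a b :=
    hV.of_dist_le (C := 1) fun x _ y _ ↦ by
      rw [one_mul, Real.dist_eq, dist_eq_norm]
      exact abs_norm_sub_norm_le _ _
  simpa only [sq] using hVn.fun_mul hVn

/-- If `φ` is continuous with `φ a ≤ c ≤ φ b`, it attains `c` at a time up to which `φ ≤ c`. -/
theorem exists_first_hitting_time {φ : ℝ → ℝ} {a b c : ℝ} (hab : a ≤ b)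
    (hφ : ContinuousOn φ (Icc a b)) (ha : φ a ≤ c) (hb : c ≤ φ b) :
    ∃ T ∈ Icc a b, φ T = c ∧ ∀ t ∈ Icc a T, φ t ≤ c := by
  have hcpt : IsCompact (Icc a b ∩ φ ⁻¹' Ici c) :=
    isCompact_Icc.of_isClosed_subset (hφ.preimage_isClosed_of_isClosed isClosed_Icc isClosed_Ici)
      inter_subset_left
  obtain ⟨T, ⟨hT, hcT⟩, hleast⟩ := hcpt.exists_isLeast ⟨b, ⟨hab, le_rfl⟩, hb⟩
  have hTc : φ T = c := by
    obtain ⟨s, hs, hsc⟩ := intermediate_value_Icc hT.1 (hφ.mono (Icc_subset_Icc_right hT.2))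
      ⟨ha, hcT⟩
    have : T ≤ s := hleast ⟨⟨hs.1, hs.2.trans hT.2⟩, hsc.ge⟩
    rwa [le_antisymm this hs.2]
  refine ⟨T, hT, hTc, fun t ht ↦ ?_⟩
  by_contra! hlt
  have : T ≤ t := hleast ⟨⟨ht.1, ht.2.trans hT.2⟩, hlt.le⟩
  rw [le_antisymm ht.2 this, hTc] at hlt
  exact lt_irrefl c hlt

/-- If `f ≥ 0` and `‖l‖` are square integrable, then `f (1 + ‖l‖)` is integrable. -/
theorem integrable_mul_one_add_norm {α E : Type*} [MeasurableSpace α] {μ : Measure α}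
    [IsFiniteMeasure μ] [NormedAddCommGroup E] {f : α → ℝ} {l : α → E} (hf0 : ∀ t, 0 ≤ f t)
    (hf : Integrable (fun t ↦ f t ^ 2) μ) (hlm : AEStronglyMeasurable l μ)
    (hl : Integrable (fun t ↦ ‖l t‖ ^ 2) μ) :
    Integrable (fun t ↦ f t * (1 + ‖l t‖)) μ := by
  have hfm : AEStronglyMeasurable f μ := by
    have := Real.continuous_sqrt.comp_aestronglyMeasurable hf.aestronglyMeasurable
    simpa only [Real.sqrt_sq (hf0 _)] using this
  have hf2 : MemLp f 2 μ := (memLp_two_iff_integrable_sq hfm).2 hf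
  have hl2 : MemLp (fun t ↦ ‖l t‖) 2 μ := (memLp_two_iff_integrable_sq hlm.norm).2 hl
  have hl1 : MemLp (fun t ↦ 1 + ‖l t‖) 2 μ := (memLp_const (1 : ℝ)).add hl2
  exact hf2.integrable_mul hl1

/-- Osgood-type uniqueness for the controlled equation: under the
local integrability condition and the local Osgood-type condition, any two
solutions driven by the same control coincide on `[0,1]`. -/
theorem controlled_equation_uniqueness {d m : ℕ} (hd : 1 ≤ d) (hm : 1 ≤ m)
    (x₀ : EuclideanSpace ℝ (Fin d))
    (b : ℝ → EuclideanSpace ℝ (Fin d) → EuclideanSpace ℝ (Fin d))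
    (σ : ℝ → EuclideanSpace ℝ (Fin d) → Matrix (Fin d) (Fin m) ℝ)
    (hbmeas : Measurable (Function.uncurry b))
    (hσmeas : ∀ i j, Measurable fun p : ℝ × EuclideanSpace ℝ (Fin d) => σ p.1 p.2 i j)
    -- local integrability: ∫₀¹ sup_{|x| ≤ R} (|b(s,x)| + ‖σ(s,x)‖²) ds < ∞ for all R > 0
    (hloc : ∀ R > (0:ℝ), ∫⁻ s in Icc (0:ℝ) 1,
      ⨆ x ∈ Metric.closedBall (0 : EuclideanSpace ℝ (Fin d)) R,
        ENNReal.ofReal (‖b s x‖ + frobSq (σ s x)) < ⊤)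
    -- local Osgood-type condition
    (c₀ : ℝ) (hc₀ : c₀ ∈ Ioo (0:ℝ) 1)
    (hOsg : ∀ R > (0:ℝ), ∃ f η : ℝ → ℝ,
      (∀ t, 0 ≤ f t) ∧ IntegrableOn (fun t => f t ^ 2) (Icc 0 1) ∧
      DifferentiableOn ℝ η (Ico 0 1) ∧ η 0 = 0 ∧
      (∀ u ∈ Ico (0:ℝ) 1, 0 ≤ η u) ∧
      (∀ u ∈ Ico (0:ℝ) 1, 0 ≤ derivWithin η (Ico 0 1) u) ∧
      (∀ ε ∈ Ioo (0:ℝ) 1, ∫⁻ u in Ioc (0:ℝ) ε, ENNReal.ofReal (1 / η u) = ⊤) ∧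
      (∀ t ∈ Icc (0:ℝ) 1, ∀ x y : EuclideanSpace ℝ (Fin d),
        max ‖x‖ ‖y‖ ≤ R → ‖x - y‖ < c₀ →
        max ⟪x - y, b t x - b t y⟫ ‖mVecT (σ t x - σ t y) (x - y)‖
          ≤ f t * η (‖x - y‖ ^ 2)))
    :
    ∀ l' : ℝ → EuclideanSpace ℝ (Fin m), Adm l' →
      ∀ h₁ h₂ : ℝ → EuclideanSpace ℝ (Fin d),
        IsSol b σ x₀ l' h₁ → IsSol b σ x₀ l' h₂ →
        ∀ t ∈ Icc (0:ℝ) 1, h₁ t = h₂ t := by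
  intro l' hl h₁ h₂ hs₁ hs₂ t ht
  have hg₁ := integrableOn_drift hbmeas hσmeas hloc hl hs₁.1
  have hg₂ := integrableOn_drift hbmeas hσmeas hloc hl hs₂.1
  set g : ℝ → EuclideanSpace ℝ (Fin d) := fun s ↦
    (b s (h₁ s) + mVec (σ s (h₁ s)) (l' s)) - (b s (h₂ s) + mVec (σ s (h₂ s)) (l' s)) with hg
  have hgint : IntervalIntegrable g volume 0 1 :=
    (intervalIntegrable_iff_integrableOn_Icc_of_le zero_le_one).2 (hg₁.sub hg₂)
  have hsub : ∀ s ∈ Icc (0 : ℝ) 1, uIcc 0 s ⊆ Icc 0 1 := fun s hs ↦ by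
    rw [uIcc_of_le hs.1]
    exact Icc_subset_Icc_right hs.2
  have hV : ∀ s ∈ Icc (0 : ℝ) 1, ∫ r in (0 : ℝ)..s, g r = h₁ s - h₂ s := by
    intro s hs
    rw [hs₁.2 s hs, hs₂.2 s hs, add_sub_add_left_eq_sub, hg]
    exact intervalIntegral.integral_sub (hg₁.mono_set (hsub s hs)).intervalIntegrable
      (hg₂.mono_set (hsub s hs)).intervalIntegrable
  set φ : ℝ → ℝ := fun s ↦ ‖∫ r in (0 : ℝ)..s, g r‖ ^ 2 with hφ
  have hφac : AbsolutelyContinuousOnInterval φ 0 1 :=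
    absolutelyContinuousOnInterval_norm_sq_integral hgint
  have hφ0 : φ 0 = 0 := by simp [hφ]
  by_contra hne
  have hφt : 0 < φ t := by
    simp only [hφ, hV t ht]
    have := norm_pos_iff.2 (sub_ne_zero.2 hne)
    positivity
  obtain ⟨R₁, hR₁⟩ := isCompact_Icc.exists_bound_of_continuousOn hs₁.1
  obtain ⟨R₂, hR₂⟩ := isCompact_Icc.exists_bound_of_continuousOn hs₂.1
  obtain ⟨f, η, hf0, hf, hηd, -, hη0, -, hdiv, hfη⟩ :=
    hOsg (max (max R₁ R₂) 1) (by positivity)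
  have hc₀0 := hc₀.1
  set c : ℝ := min (φ t) (c₀ ^ 2 / 2)
  have hc0 : 0 < c := lt_min hφt (by positivity)
  have hcc₀ : c < c₀ ^ 2 := (min_le_right _ _).trans_lt (half_lt_self (by positivity))
  have hc1 : c < 1 := hcc₀.trans (pow_lt_one₀ hc₀0.le hc₀.2 two_ne_zero)
  obtain ⟨T, hT, hφT, hφc⟩ := exists_first_hitting_time ht.1
    (hφac.continuousOn.mono (by rw [uIcc_of_le zero_le_one]; exact Icc_subset_Icc_right ht.2))
    (hφ0.trans_le hc0.le) (min_le_left _ _)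
  have hT1 : T ∈ Icc (0 : ℝ) 1 := ⟨hT.1, hT.2.trans ht.2⟩
  have hk : IntegrableOn (fun s ↦ 2 * (f s * (1 + ‖l' s‖))) (Icc 0 1) :=
    (integrable_mul_one_add_norm hf0 hf hl.1 hl.2).const_mul 2
  have hderiv : ∀ᵐ s, s ∈ Icc 0 T → deriv φ s ≤ 2 * (f s * (1 + ‖l' s‖)) * η (φ s) := by
    filter_upwards [hgint.ae_hasDerivAt_integral] with s hs hsT
    have hs1 : s ∈ Icc (0 : ℝ) 1 := ⟨hsT.1, hsT.2.trans hT1.2⟩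
    have hd := (hs (by rwa [uIcc_of_le zero_le_one]) 0 left_mem_uIcc).norm_sq
    have hφs : φ s = ‖h₁ s - h₂ s‖ ^ 2 := by simp only [hφ, hV s hs1]
    have hlt : ‖h₁ s - h₂ s‖ < c₀ :=
      lt_of_pow_lt_pow_left₀ 2 hc₀0.le (hφs ▸ (hφc s hsT).trans_lt hcc₀)
    have hmax := max_le_iff.1 (hfη s hs1 (h₁ s) (h₂ s)
      (max_le ((hR₁ s hs1).trans ((le_max_left _ _).trans (le_max_left _ _)))
        ((hR₂ s hs1).trans ((le_max_right _ _).trans (le_max_left _ _)))) hlt)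
    rw [← hφs] at hmax
    have hinner : ⟪h₁ s - h₂ s, g s⟫ = ⟪h₁ s - h₂ s, b s (h₁ s) - b s (h₂ s)⟫
        + ⟪mVecT (σ s (h₁ s) - σ s (h₂ s)) (h₁ s - h₂ s), l' s⟫ := by
      rw [← inner_mVec_eq_inner_mVecT, ← inner_add_right, ← mVec_sub_mVec, ← add_sub_add_comm]
    have hcs := (real_inner_le_norm (mVecT (σ s (h₁ s) - σ s (h₂ s)) (h₁ s - h₂ s)) (l' s)).trans
      (mul_le_mul_of_nonneg_right hmax.2 (norm_nonneg (l' s)))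
    rw [hd.deriv, hV s hs1, hinner]
    linarith [hmax.1]
  have hfin := lintegral_one_div_le hT.1
    (hφac.mono (by rw [uIcc_of_le zero_le_one]; exact hsub T hT1)) hφ0 hφT
    (fun s hs ↦ ⟨sq_nonneg _, hφc s hs⟩)
    (hηd.continuousOn.mono fun u hu ↦ ⟨hu.1, hu.2.trans_lt hc1⟩)
    (fun u hu ↦ hη0 u ⟨hu.1, hu.2.trans_lt hc1⟩)
    (hk.mono_set (hsub T hT1)).intervalIntegrable
    (fun s ↦ by have := hf0 s; positivity) hderiv
  rw [hdiv c ⟨hc0, hc1⟩] at hfin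
  exact ENNReal.ofReal_ne_top (top_le_iff.1 hfin)
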